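/- arXiv:2011.07607 — 2 statements merged into one kernel-verified Lean document; each statement's English description precedes it below -/
import Mathlib

section
/- Let k ≥ 1 be an integer, let α_i = -1 + 2i/k for i = 0,…,k, let μ ∈ ℝ and σ > 0, and let p̃_i = Φ_{μ,σ}(α_i) − Φ_{μ,σ}(α_{i−1}) for i = 1,…,k. Then the unnormalized sequence p̃_1,…,p̃_k is unimodal, i.e., there exists j ∈ {1,…,k} such that p̃_1 ≤ p̃_2 ≤ … ≤ p̃_j ≥ p̃_{j+1} ≥ … ≥ p̃_k. -/
open MeasureTheory ProbabilityTheory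

/-- `Phi μ σ t` is the CDF of the normal distribution `N(μ, σ²)` evaluated at `t`. -/
noncomputable def Phi (μ σ : ℝ) (t : ℝ) : ℝ :=
  ((gaussianReal μ (σ ^ 2).toNNReal) (Set.Iic t)).toReal

lemma Phi_sub_Phi (μ : ℝ) {σ : ℝ} (hσ : 0 < σ) (a b : ℝ) :
    Phi μ σ b - Phi μ σ a = ∫ x in a..b, gaussianPDFReal μ (σ ^ 2).toNNReal x := by
  have hv : (σ ^ 2).toNNReal ≠ 0 := (Real.toNNReal_pos.2 (by positivity)).ne'
  have hPhi (t : ℝ) :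
      Phi μ σ t = ∫ x in Set.Iic t, gaussianPDFReal μ (σ ^ 2).toNNReal x := by
    rw [Phi, gaussianReal_apply_eq_integral μ hv, ENNReal.toReal_ofReal]
    exact integral_nonneg fun x => gaussianPDFReal_nonneg _ _ _
  rw [hPhi, hPhi]
  exact intervalIntegral.integral_Iic_sub_Iic
    (integrable_gaussianPDFReal _ _).integrableOn (integrable_gaussianPDFReal _ _).integrableOn

lemma gaussianPDFReal_le_of_abs_sub_le {μ x y : ℝ} (v : NNReal) (h : |x - μ| ≤ |y - μ|) :
    gaussianPDFReal μ v y ≤ gaussianPDFReal μ v x := by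
  have := sq_le_sq.2 h
  simp only [gaussianPDFReal]
  gcongr

lemma integral_gaussianPDFReal_next (μ : ℝ) (v : NNReal) (a h : ℝ) :
    ∫ x in a..a + h, gaussianPDFReal μ v x =
      ∫ x in a - h..a, gaussianPDFReal μ v (x + h) := by
  rw [intervalIntegral.integral_comp_add_right, sub_add_cancel]

/-- Left of the mean, the Gaussian mass of a bin is at most that of the next bin. -/
lemma Phi_sub_le_next {μ σ a h : ℝ} (hσ : 0 < σ) (hh : 0 ≤ h) (ha : a + h / 2 ≤ μ) :
    Phi μ σ a - Phi μ σ (a - h) ≤ Phi μ σ (a + h) - Phi μ σ a := by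
  rw [Phi_sub_Phi μ hσ, Phi_sub_Phi μ hσ, integral_gaussianPDFReal_next]
  refine intervalIntegral.integral_mono_on (by linarith)
    (integrable_gaussianPDFReal _ _).intervalIntegrable
    ((integrable_gaussianPDFReal _ _).comp_add_right h).intervalIntegrable fun x hx => ?_
  refine gaussianPDFReal_le_of_abs_sub_le _ ?_
  rw [abs_of_nonpos (by linarith [hx.2] : x - μ ≤ 0), abs_le]
  constructor <;> linarith [hx.2]

/-- Right of the mean, the Gaussian mass of a bin is at least that of the next bin. -/
lemma Phi_next_le_sub {μ σ a h : ℝ} (hσ : 0 < σ) (hh : 0 ≤ h) (ha : μ ≤ a - h / 2) :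
    Phi μ σ (a + h) - Phi μ σ a ≤ Phi μ σ a - Phi μ σ (a - h) := by
  rw [Phi_sub_Phi μ hσ, Phi_sub_Phi μ hσ, integral_gaussianPDFReal_next]
  refine intervalIntegral.integral_mono_on (by linarith)
    ((integrable_gaussianPDFReal _ _).comp_add_right h).intervalIntegrable
    (integrable_gaussianPDFReal _ _).intervalIntegrable fun x hx => ?_
  refine gaussianPDFReal_le_of_abs_sub_le _ ?_
  rw [abs_of_nonneg (by linarith [hx.1] : 0 ≤ x + h - μ), abs_le]
  constructor <;> linarith [hx.1]

/-- A sequence whose descents persist is unimodal on `{1, …, k}`. -/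
lemma exists_unimodal_index {k : ℕ} (hk : 1 ≤ k) {p : ℕ → ℝ}
    (hp : ∀ i n, 1 ≤ i → i < n → p (i + 1) < p i → p (n + 1) ≤ p n) :
    ∃ j, 1 ≤ j ∧ j ≤ k ∧ (∀ i, 1 ≤ i → i < j → p i ≤ p (i + 1)) ∧
      (∀ i, j ≤ i → i < k → p (i + 1) ≤ p i) := by
  classical
  have hex : ∃ j, 1 ≤ j ∧ (j = k ∨ p (j + 1) < p j) := ⟨k, hk, Or.inl rfl⟩
  obtain ⟨h1, hj⟩ := Nat.find_spec hex
  refine ⟨Nat.find hex, h1, Nat.find_min' hex ⟨hk, Or.inl rfl⟩, fun i hi hij => ?_,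
    fun i hji hik => ?_⟩
  · by_contra! hlt
    exact Nat.find_min hex hij ⟨hi, Or.inr hlt⟩
  · rcases hj with hj | hj
    · omega
    · rcases hji.eq_or_lt with heq | hlt
      · rw [← heq]
        exact hj.le
      · exact hp _ i h1 hlt hj

theorem stmt_1 (k : ℕ) (hk : 1 ≤ k) (μ σ : ℝ) (hσ : 0 < σ)
    (α : ℕ → ℝ) (hα : ∀ i, α i = -1 + 2 * (i : ℝ) / (k : ℝ))
    (ptilde : ℕ → ℝ)
    (hpt : ∀ i, ptilde i = Phi μ σ (α i) - Phi μ σ (α (i - 1))) :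
    ∃ j, 1 ≤ j ∧ j ≤ k ∧
      (∀ i, 1 ≤ i → i < j → ptilde i ≤ ptilde (i + 1)) ∧
      (∀ i, j ≤ i → i < k → ptilde (i + 1) ≤ ptilde i) := by
  have hk0 : (0 : ℝ) < k := by exact_mod_cast hk
  have hstep (i : ℕ) : α (i + 1) = α i + 2 / k := by
    rw [hα, hα]
    push_cast
    ring
  have hp_succ (i : ℕ) : ptilde (i + 1) = Phi μ σ (α i + 2 / k) - Phi μ σ (α i) := by
    rw [hpt, hstep, Nat.add_sub_cancel]
  have hp_self (i : ℕ) (hi : 1 ≤ i) :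
      ptilde i = Phi μ σ (α i) - Phi μ σ (α i - 2 / k) := by
    obtain ⟨m, rfl⟩ := Nat.exists_eq_add_of_le' hi
    rw [hp_succ, hstep, add_sub_cancel_right]
  have hh : (0 : ℝ) ≤ 2 / k := by positivity
  refine exists_unimodal_index hk fun i n hi hin hlt => ?_
  have hμ : μ < α i + 2 / k / 2 := by
    by_contra! hle
    rw [hp_succ, hp_self i hi] at hlt
    exact hlt.not_ge (Phi_sub_le_next hσ hh hle)
  have hmono : α (i + 1) ≤ α n :=
    monotone_nat_of_le_succ (fun m => by linarith [hstep m]) (Nat.succ_le_of_lt hin)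
  rw [hp_succ, hp_self n (hi.trans hin.le)]
  exact Phi_next_le_sub hσ hh (by linarith [hstep i])
end

section
/- There exist real numbers α_1 < α_2 < α_3 and s ∈ ℝ such that, setting F(t) = 1/(1 + exp(−t)) and p_1 = F(α_1 − s), p_2 = F(α_2 − s) − F(α_1 − s), p_3 = F(α_3 − s) − F(α_2 − s), p_4 = 1 − F(α_3 − s), one has p_1 > p_2, p_2 < p_3, and p_3 > p_4; that is, the output probabilities of the Proportional Odds Model are in general not unimodal. -/
theorem stmt_12 : ∃ (α₁ α₂ α₃ s : ℝ), α₁ < α₂ ∧ α₂ < α₃ ∧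
    (fun F : ℝ → ℝ =>
      F (α₁ - s) > F (α₂ - s) - F (α₁ - s) ∧
      F (α₂ - s) - F (α₁ - s) < F (α₃ - s) - F (α₂ - s) ∧
      F (α₃ - s) - F (α₂ - s) > 1 - F (α₃ - s))
    (fun t => 1 / (1 + Real.exp (-t))) := by
  have h2 : Real.exp (Real.log 2) = 2 := Real.exp_log (by norm_num)
  have h4 : Real.exp (Real.log 4) = 4 := Real.exp_log (by norm_num)
  refine ⟨-Real.log 2, 0, Real.log 4, 0, neg_lt_zero.mpr (Real.log_pos (by norm_num)),
    Real.log_pos (by norm_num), ?_⟩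
  simp only [sub_zero, neg_neg, neg_zero, Real.exp_zero, Real.exp_neg (Real.log 4), h2, h4]
  norm_num
end
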